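/- In 2×2×3 Abalone, if Gray occupies both middle spaces, then either Gray has a winning strategy (o(C) = R), or the negative constellation -C contains the neutral subconfiguration, in which case o(C) = N. -/

import Mathlib

/-- An abstract two-player game with perfect information and alternating moves.
`true` denotes Left (Black) and `false` denotes Right (Gray). -/
structure AGame (P : Type*) where
  /-- `move pl p q` : player `pl` has a legal move from position `p` to position `q`. -/
  move : Bool → P → P → Prop
  /-- `win pl p` : the position `p` is a terminal win for player `pl`. -/
  win : Bool → P → Prop

namespace AGame

variable {P : Type*}

/-- `FW G pl turn p` : player `pl` can force a win (in finitely many moves)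
from position `p` when it is `turn`'s move. -/
inductive FW (G : AGame P) (pl : Bool) : Bool → P → Prop
  | terminal (turn : Bool) (p : P) : G.win pl p → FW G pl turn p
  | self (p q : P) : ¬ G.win (!pl) p → G.move pl p q → FW G pl (!pl) q → FW G pl pl p
  | opp (p : P) : ¬ G.win (!pl) p → (∃ q, G.move (!pl) p q) →
      (∀ q, G.move (!pl) p q → FW G pl pl q) → FW G pl (!pl) p

/-- Outcome class `L` : Left (Black) always wins, whoever moves first. -/
def OutL (G : AGame P) (p : P) : Prop := G.FW true true p ∧ G.FW true false p

/-- Outcome class `R` : Right (Gray) always wins, whoever moves first. -/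
def OutR (G : AGame P) (p : P) : Prop := G.FW false false p ∧ G.FW false true p

/-- Outcome class `N` : whoever moves next wins. -/
def OutN (G : AGame P) (p : P) : Prop := G.FW true true p ∧ G.FW false false p

/-- Outcome class `D` : neither player can force a win (optimal play is an infinite draw). -/
def OutD (G : AGame P) (p : P) : Prop :=
  ¬ G.FW true true p ∧ ¬ G.FW true false p ∧ ¬ G.FW false true p ∧ ¬ G.FW false false p

/-- Outcome class `N̂` : Left wins moving first, and the game is a draw if Right moves first. -/
def OutNhat (G : AGame P) (p : P) : Prop :=
  G.FW true true p ∧ ¬ G.FW true false p ∧ ¬ G.FW false false p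

/-- Outcome class `Ň` : Right wins moving first, and the game is a draw if Left moves first. -/
def OutNcheck (G : AGame P) (p : P) : Prop :=
  G.FW false false p ∧ ¬ G.FW false true p ∧ ¬ G.FW true true p

end AGame

namespace Abalone

/-- A board cell, in axial hexagonal coordinates `(q, r)` where `q` is the column. -/
abbrev Cell : Type := ℤ × ℤ

/-- A constellation: each cell carries a black marble (`some true`),
a gray marble (`some false`), or is empty (`none`). -/
abbrev Pos : Type := Cell → Option Bool

/-- The six unit directions of the hexagonal grid. -/
def dirs : List Cell := [(1, 0), (0, 1), (-1, 1), (-1, 0), (0, -1), (1, -1)]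

/-- Add a direction to a cell. -/
def addc (x d : Cell) : Cell := (x.1 + d.1, x.2 + d.2)

/-- The cell `n` steps from `x` in direction `d`. -/
def stepc (x : Cell) (n : ℕ) (d : Cell) : Cell := (x.1 + (n : ℤ) * d.1, x.2 + (n : ℤ) * d.2)

/-- The opposite direction. -/
def negd (d : Cell) : Cell := (-d.1, -d.2)

open Classical in
/-- The result of shifting the line of `len` marbles starting one step after `x`
(in direction `d`, with the marble at `x` itself moving into the vacated space):
cell `x` is vacated, each cell `x + i·d` (`1 ≤ i ≤ len`) receives the content of its
predecessor, and marbles shifted off the board are removed. -/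
noncomputable def shiftResult (board : Finset Cell) (c : Pos) (x d : Cell) (len : ℕ) : Pos :=
  fun y =>
    if y ∉ board then none
    else if y = x then none
    else if ∃ i : ℕ, 1 ≤ i ∧ i ≤ len ∧ y = stepc x i d then c (addc y (negd d))
    else c y

/-- In-line movement (including sumito pushes): player `pl` moves a line of `k` of their
own contiguous marbles (`1 ≤ k ≤ maxG`) one step in the line's direction `d`, possibly
pushing a strictly shorter opposing line of `m < k` marbles, the leading opposing marble
being pushed either onto an empty board cell or off the board. -/
def InlineMove (board : Finset Cell) (maxG : ℕ) (pl : Bool) (c c' : Pos) : Prop :=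
  ∃ x d, d ∈ dirs ∧ ∃ k m : ℕ,
    1 ≤ k ∧ k ≤ maxG ∧ m < k ∧
    (∀ i < k, stepc x i d ∈ board ∧ c (stepc x i d) = some pl) ∧
    (∀ i, k ≤ i → i < k + m → stepc x i d ∈ board ∧ c (stepc x i d) = some (!pl)) ∧
    ((m = 0 ∧ stepc x k d ∈ board ∧ c (stepc x k d) = none) ∨
      (1 ≤ m ∧ (stepc x (k + m) d ∉ board ∨ c (stepc x (k + m) d) = none))) ∧
    c' = shiftResult board c x d (k + m)

open Classical in
/-- The result of a broadside move: the `k` marbles at `x + i·d` (`i < k`) each move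
one step in direction `e`. -/
noncomputable def broadResult (c : Pos) (pl : Bool) (x d e : Cell) (k : ℕ) : Pos :=
  fun y =>
    if ∃ i < k, y = stepc x i d then none
    else if ∃ i < k, y = addc (stepc x i d) e then some pl
    else c y

/-- Broadside movement: player `pl` moves a line of `k` of their own contiguous marbles
(`1 ≤ k ≤ maxG`, the line in direction `d`) one step in a direction `e` not along the
line, each marble landing on an empty board cell. -/
def BroadsideMove (board : Finset Cell) (maxG : ℕ) (pl : Bool) (c c' : Pos) : Prop :=
  ∃ x d e, d ∈ dirs ∧ e ∈ dirs ∧ e ≠ d ∧ e ≠ negd d ∧ ∃ k : ℕ,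
    1 ≤ k ∧ k ≤ maxG ∧
    (∀ i < k, stepc x i d ∈ board ∧ c (stepc x i d) = some pl) ∧
    (∀ i < k, addc (stepc x i d) e ∈ board ∧ c (addc (stepc x i d) e) = none) ∧
    c' = broadResult c pl x d e k

/-- A legal Abalone move for player `pl`. -/
def Move (board : Finset Cell) (maxG : ℕ) (pl : Bool) (c c' : Pos) : Prop :=
  InlineMove board maxG pl c c' ∨ BroadsideMove board maxG pl c c'

/-- The number of marbles of player `pl` on the board. -/
def countM (board : Finset Cell) (pl : Bool) (c : Pos) : ℕ :=
  (board.filter (fun y => c y = some pl)).card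

/-- Player `pl` has won: the opponent has fewer than `n` marbles left,
i.e. at least one opposing marble has been pushed off the board. -/
def Wins (board : Finset Cell) (n : ℕ) (pl : Bool) (c : Pos) : Prop :=
  countM board (!pl) c < n

/-- The negative of a constellation: swap black and gray marbles. -/
def negP (c : Pos) : Pos := fun y => (c y).map (fun b => !b)

end Abalone

namespace Abalone

/-! ### The 2×2×3 Abalone board

A hexagonal grid of 10 cells with columns of sizes 3, 4, 3, labelled as in the paper:
`a, b, c` the left column (bottom to top), `d, e, f, g` the middle column (bottom to
top, with `e, f` the two central spaces), and `h, i, j` the right column (bottom to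
top). Each player has 3 marbles, may move 1–3 contiguous marbles, a strictly longer
line pushes a shorter opposing line, and a player wins by ejecting one opposing
marble. -/

def ca : Cell := (-1, 2)
def cb : Cell := (-1, 1)
def cc : Cell := (-1, 0)
def cd : Cell := (0, 2)
def ce : Cell := (0, 1)
def cf : Cell := (0, 0)
def cg : Cell := (0, -1)
def ch : Cell := (1, 1)
def ci : Cell := (1, 0)
def cj : Cell := (1, -1)

def board223 : Finset Cell := {ca, cb, cc, cd, ce, cf, cg, ch, ci, cj}

/-- 2×2×3 Abalone as a game: moves of 1–3 contiguous marbles, win by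
reducing the opponent to fewer than 3 marbles. -/
def G223 : AGame Pos :=
  { move := Move board223 3
    win := Wins board223 3 }

/-- The constellation with black marbles on `b1, b2, b3` and gray marbles
on `g1, g2, g3`. -/
def mk3 (b1 b2 b3 g1 g2 g3 : Cell) : Pos := fun y =>
  if y = b1 ∨ y = b2 ∨ y = b3 then some true
  else if y = g1 ∨ y = g2 ∨ y = g3 then some false
  else none

/-- The boards `C0`–`C8` of the paper (Figure 8). -/
def C0 : Pos := mk3 cc cg cj ca cd ch
def C1 : Pos := mk3 cc cf cg ca cd ch
def C2 : Pos := mk3 cc cf cg ca cd ce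
def C3 : Pos := mk3 cc cf cg ce cd ch
def C4 : Pos := mk3 cb cf cg ca cd ce
def C5 : Pos := mk3 cc cb cg ca cd ce
def C6 : Pos := mk3 cb cf cg ce cd ci
def C7 : Pos := mk3 cb cc cg ci cd ce
def C8 : Pos := mk3 cc cf cg ci cd ce

/-- A valid 2×2×3 constellation: all marbles on the board,
3 black and 3 gray marbles. -/
def Valid223 (c : Pos) : Prop :=
  (∀ y, y ∉ board223 → c y = none) ∧
  countM board223 true c = 3 ∧ countM board223 false c = 3

/-- `c` contains (up to the symmetries of the board) the neutral subconfiguration: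
two Gray marbles in a corner column pair threaten an adjacent Black marble in the
same column (e.g. Gray on `a` and `b` threatening Black on `c`). -/
def ContainsNeutral (c : Pos) : Prop :=
  (c ca = some false ∧ c cb = some false ∧ c cc = some true) ∨
  (c cb = some false ∧ c cc = some false ∧ c ca = some true) ∨
  (c ch = some false ∧ c ci = some false ∧ c cj = some true) ∨
  (c ci = some false ∧ c cj = some false ∧ c ch = some true)

end Abalone

namespace Abalone

/-- The cells of the board, with the two middle spaces first. -/
def cells : List Cell := [ce, cf, ca, cb, cc, cd, cg, ch, ci, cj]

/-- A local rewriting rule: triples of a cell, its content before, and its content after. -/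
abbrev Rule : Type := List (Cell × Option Bool × Option Bool)

/-- The rule `r` applies to `c` and turns it into `c'`. -/
def Fires (r : Rule) (c c' : Pos) : Prop :=
  (∀ t ∈ r, c t.1 = t.2.1 ∧ c' t.1 = t.2.2) ∧ ∀ y, (∀ t ∈ r, t.1 ≠ y) → c' y = c y

/-- The content of the `i`-th cell of `k` marbles of `pl` facing `m` opposing ones. -/
def lineContent (pl : Bool) (k m i : ℕ) : Option Bool :=
  if i < k then some pl else if i < k + m then some (!pl) else none

/-- The rule of an in-line move of `k` marbles against `m` opposing ones. -/
def inlineRule (pl : Bool) (x d : Cell) (k m : ℕ) : Rule :=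
  ((List.range (k + m + 1)).filter fun i => stepc x i d ∈ cells).map fun i =>
    (stepc x i d, lineContent pl k m i, if i = 0 then none else lineContent pl k m (i - 1))

/-- The line of an in-line move stays on the board, up to a possibly ejected marble. -/
def InlineFits (x d : Cell) (k m : ℕ) : Prop :=
  (∀ i < k + m, stepc x i d ∈ cells) ∧ (m = 0 → stepc x k d ∈ cells)

instance (x d : Cell) (k m : ℕ) : Decidable (InlineFits x d k m) :=
  inferInstanceAs (Decidable (_ ∧ _))

/-- The rule of a broadside move of `k` marbles in direction `e`. -/
def broadRule (pl : Bool) (x d e : Cell) (k : ℕ) : Rule :=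
  ((List.range k).map fun i => (stepc x i d, some pl, none)) ++
    (List.range k).map fun i => (addc (stepc x i d) e, none, some pl)

/-- A broadside move starts and ends on the board. -/
def BroadFits (x d e : Cell) (k : ℕ) : Prop :=
  e ≠ d ∧ e ≠ negd d ∧ ∀ i < k, stepc x i d ∈ cells ∧ addc (stepc x i d) e ∈ cells

instance (x d e : Cell) (k : ℕ) : Decidable (BroadFits x d e k) :=
  inferInstanceAs (Decidable (_ ∧ _ ∧ _))

/-- The rules of all in-line moves of `pl`. -/
def inlineRules (pl : Bool) : List Rule :=
  cells.flatMap fun x => dirs.flatMap fun d => [1, 2, 3].flatMap fun k =>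
    ((List.range k).filter fun m => InlineFits x d k m).map (inlineRule pl x d k)

/-- The rules of all broadside moves of `pl`. -/
def broadRules (pl : Bool) : List Rule :=
  cells.flatMap fun x => dirs.flatMap fun d => dirs.flatMap fun e =>
    ([1, 2, 3].filter fun k => BroadFits x d e k).map (broadRule pl x d e)

/-- The rules of all moves of `pl`. -/
def rules (pl : Bool) : List Rule := inlineRules pl ++ broadRules pl

/-- The position of the bit recording that the cell `y` has content `o`. -/
def slot (y : Cell) (o : Option Bool) : ℕ :=
  (3 * (4 * (y.1 + 1) + (y.2 + 1))).toNat + o.elim 0 fun b => bif b then 1 else 2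

/-- The bits of a list of cells with contents. -/
def mask (l : List (Cell × Option Bool)) : ℕ :=
  l.foldr (fun t s => 2 ^ slot t.1 t.2 ||| s) 0

/-- The bits a rule needs and removes, and those which it adds. -/
def ruleMasks (r : Rule) : ℕ × ℕ :=
  (mask (r.map fun t => (t.1, t.2.1)), mask (r.map fun t => (t.1, t.2.2)))

/-- The masks of the rules of all Black moves. -/
def blackMoves : List (ℕ × ℕ) := [
  (593920, 335872), (606208, 335872), (2686976, 4751360), (8978432, 4751360), (1160, 656),
  (1184, 656), (134743040, 268960256), (537396224, 268960256), (1074266240, 2148008000),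
  (4295491712, 2148008000), (16842880, 33620032), (67174528, 33620032), (134283280, 268501000),
  (536936464, 268501000), (656, 1160), (2192, 1160), (4751360, 2686976), (4853760, 2703360),
  (4788224, 2695168), (4800512, 2695168), (335872, 593920), (3219456, 8982528),
  (2695168, 4788224), (8986624, 4788224), (2148008000, 1074266240), (2148008192, 1074266240),
  (2432696320, 1375731712), (2483027968, 1375731712), (268960256, 134743040),
  (268961792, 134743040), (268501000, 134283280), (268501024, 134283280),
  (1375731712, 2432696320), (4596957184, 2432696320), (33620032, 16842880), (33620224, 16842880),
  (524800, 263168), (134742016, 268697600), (1074266112, 2147745792), (2621440, 4456448),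
  (524352, 262272), (557056, 327680), (1208549376, 2416214016), (590400, 296064),
  (589896, 295056), (151584768, 302284800), (65600, 32896), (16842752, 33587200),
  (134283264, 268468224), (327680, 557056), (65544, 32784), (69632, 40960), (263168, 524800),
  (2098176, 4194816), (1076364288, 2151940608), (1088, 640), (558144, 328320), (2622080, 4457536),
  (557192, 327760), (134774912, 268763200), (2360448, 4719168), (296064, 590400), (32896, 65600),
  (262272, 524352), (134545536, 268992576), (640, 1088), (328320, 558144), (136, 80),
  (69768, 41040), (327760, 557192), (16846864, 33595400), (295056, 589896), (2393232, 4784712),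
  (37008, 73800), (300176, 598600), (4112, 8200), (32784, 65544), (80, 136), (4457536, 2622080),
  (1078199296, 2150105600), (4719168, 2360448), (4784712, 2393232), (1077936128, 2149580800),
  (1212678144, 2418278400), (1229520896, 2451865600), (4194816, 2098176), (4456448, 2621440),
  (151068672, 302026752), (1225334784, 2449772544), (73800, 37008), (598600, 300176),
  (16818192, 33624072), (41040, 69768), (8200, 4112), (16785408, 33558528), (40960, 69632),
  (2151940608, 1076364288), (2286157824, 1344798720), (2150105600, 1078199296),
  (2282258432, 1342504960), (2282258568, 1342505040), (2149580800, 1077936128),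
  (2147745792, 1074266112), (2281701376, 1342177280), (2418278400, 1212678144),
  (2416214016, 1208549376), (1344798720, 2286157824), (268992576, 134545536),
  (285769728, 168099840), (285770816, 168100480), (1342504960, 2282258432),
  (1342505040, 2282258568), (268763200, 134774912), (285282304, 167813120),
  (268697600, 134742016), (1342177280, 2281701376), (268468224, 134283264),
  (285212672, 167772160), (302284800, 151584768), (2451865600, 1229520896),
  (302026752, 151068672), (2449772544, 1225334784), (168099840, 285769728),
  (168100480, 285770816), (33624072, 16818192), (167813120, 285282304), (33595400, 16846864),
  (33587200, 16842752), (167772160, 285212672), (33558528, 16785408)]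

/-- Masks of rules by which Gray ejects a marble. -/
def grayCaptures : List (ℕ × ℕ) := [
  (5373952, 9469952), (1187840, 409600), (4296016000, 1074790656), (67240064, 16908544),
  (269486080, 537920000), (268566560, 537001992), (2148532480, 4296015936),
  (537920512, 135268352), (33685760, 67240000), (537002000, 134348832)]

/-- Masks of rules by which Gray improves a position with both middle spaces occupied. -/
def graySteps : List (ℕ × ℕ) := [
  (16793600, 67112960), (1082130432, 4297064448), (16392, 4128), (8389120, 2099200),
  (67240000, 16908544), (4296015936, 1074790656), (4429185024, 1610612736),
  (134348832, 537001992), (2112, 768), (135268352, 537920000), (201326592, 553648128), (96, 264),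
  (9572352, 3293184), (3293184, 9572352), (1074790656, 4296015936), (537920000, 135268352)]

/-- Application of `f` to `n`, with `n` evaluated first when the kernel reduces the term. -/
def force (f : ℕ → Bool) : ℕ → Bool
  | 0 => f 0
  | n + 1 => f n.succ

/-- The rule with masks `p` applies in the state `s`. -/
def applies (s : ℕ) (p : ℕ × ℕ) : Bool := Nat.beq (s &&& p.1) p.1

/-- The state after applying the rule with masks `p` in the state `s`. -/
def update (s : ℕ) (p : ℕ × ℕ) : ℕ := (s ^^^ p.1) ||| p.2

/-- The number of marbles of `pl` in the state `s`. -/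
def marbles (pl : Bool) (s : ℕ) : ℕ := cells.countP fun y => s.testBit (slot y (some pl))

/-- Some rule from the table leaves the opponent of `pl` with fewer than three marbles. -/
def captures (table : List (ℕ × ℕ)) (pl : Bool) (s : ℕ) : Bool :=
  table.any fun p => applies s p && (marbles (!pl) (update s p)).blt 3

/-- The bits of gray marbles on both middle spaces. -/
def middleMask : ℕ := mask [(ce, some false), (cf, some false)]

/-- With Black to move, Gray has all marbles, Black is not stuck, and every Black move leads
to a state satisfying `f`. -/
def holds (f : ℕ → Bool) (s : ℕ) : Bool :=
  Nat.ble 3 (marbles false s) && blackMoves.any (applies s) &&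
    blackMoves.all fun p => !applies s p || force f (update s p)

/-- With Gray to move, Gray has all marbles and can eject a marble after at most `n` moves
from `graySteps`. -/
def grayWins : ℕ → ℕ → Bool
  | 0, s => Nat.ble 3 (marbles false s) && captures grayCaptures false s
  | n + 1, s => Nat.ble 3 (marbles false s) && (captures grayCaptures false s ||
      graySteps.any fun p => applies s p && force (holds (grayWins n)) (update s p))

/-- All ways of filling the cells of `l` with `b` black and `g` gray marbles, on top of the
state `s`, satisfy `f`. -/
def forallFillings (f : ℕ → Bool) : List Cell → ℕ → ℕ → ℕ → Bool
  | [], b, g, s => !(b.beq 0 && g.beq 0) || force f s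
  | y :: l, b, g, s =>
    (b.beq 0 || forallFillings f l b.pred g (2 ^ slot y (some true) ||| s)) &&
      ((g.beq 0 || forallFillings f l b g.pred (2 ^ slot y (some false) ||| s)) &&
        forallFillings f l b g (2 ^ slot y none ||| s))

/-- The masks of the negatives of the neutral subconfigurations. -/
def neutralMasks : List ℕ :=
  [mask [(ca, some true), (cb, some true), (cc, some false)],
    mask [(cb, some true), (cc, some true), (ca, some false)],
    mask [(ch, some true), (ci, some true), (cj, some false)],
    mask [(ci, some true), (cj, some true), (ch, some false)]]

/-- Gray wins from the state `s` if Gray moves first, and either Gray also wins if Black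
moves first, or the neutral subconfiguration lets Black win by moving first. -/
def checkState (s : ℕ) : Bool :=
  grayWins 3 s && (holds (grayWins 3) s || neutralMasks.any (fun q => applies s (q, 0)) &&
    Nat.ble 3 (marbles true s) && captures blackMoves true s)

theorem mem_board223_iff (y : Cell) : y ∈ board223 ↔ y ∈ cells := by
  simp only [board223, cells, Finset.mem_insert, Finset.mem_singleton, List.mem_cons,
    List.not_mem_nil, or_false]
  tauto

theorem mem_inlineRules {pl : Bool} {r : Rule} :
    r ∈ inlineRules pl ↔ ∃ x ∈ cells, ∃ d ∈ dirs, ∃ k m, 1 ≤ k ∧ k ≤ 3 ∧ m < k ∧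
      InlineFits x d k m ∧ r = inlineRule pl x d k m := by
  simp only [inlineRules, List.mem_flatMap, List.mem_map, List.mem_filter, List.mem_range,
    decide_eq_true_eq]
  refine exists_congr fun x => and_congr_right fun _ => exists_congr fun d =>
    and_congr_right fun _ => exists_congr fun k => ?_
  have hk : k ∈ [1, 2, 3] ↔ 1 ≤ k ∧ k ≤ 3 := by
    simp only [List.mem_cons, List.not_mem_nil, or_false]; omega
  rw [hk]
  constructor
  · rintro ⟨⟨h1, h3⟩, m, ⟨hm, hf⟩, rfl⟩
    exact ⟨m, h1, h3, hm, hf, rfl⟩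
  · rintro ⟨m, h1, h3, hm, hf, rfl⟩
    exact ⟨⟨h1, h3⟩, m, ⟨hm, hf⟩, rfl⟩

theorem mem_broadRules {pl : Bool} {r : Rule} :
    r ∈ broadRules pl ↔ ∃ x ∈ cells, ∃ d ∈ dirs, ∃ e ∈ dirs, ∃ k, 1 ≤ k ∧ k ≤ 3 ∧
      BroadFits x d e k ∧ r = broadRule pl x d e k := by
  simp only [broadRules, List.mem_flatMap, List.mem_map, List.mem_filter, decide_eq_true_eq]
  refine exists_congr fun x => and_congr_right fun _ => exists_congr fun d =>
    and_congr_right fun _ => exists_congr fun e => and_congr_right fun _ =>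
    exists_congr fun k => ?_
  have hk : k ∈ [1, 2, 3] ↔ 1 ≤ k ∧ k ≤ 3 := by
    simp only [List.mem_cons, List.not_mem_nil, or_false]; omega
  rw [hk]
  constructor
  · rintro ⟨⟨⟨h1, h3⟩, hf⟩, rfl⟩
    exact ⟨h1, h3, hf, rfl⟩
  · rintro ⟨h1, h3, hf, rfl⟩
    exact ⟨⟨⟨h1, h3⟩, hf⟩, rfl⟩

theorem stepc_zero (x d : Cell) : stepc x 0 d = x := by
  simp [stepc]

theorem stepc_left_injective {d : Cell} (hd : d ∈ dirs) (x : Cell) :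
    Function.Injective fun i : ℕ => stepc x i d := by
  intro i j h
  simp only [stepc, Prod.mk.injEq] at h
  fin_cases hd <;> simp at h <;> omega

theorem addc_stepc_succ_negd (x d : Cell) (i : ℕ) :
    addc (stepc x (i + 1) d) (negd d) = stepc x i d := by
  ext <;> simp [addc, stepc, negd] <;> ring

/-- The rule `r` can be applied to `c`. -/
def Matches (r : Rule) (c : Pos) : Prop := ∀ t ∈ r, c t.1 = t.2.1

theorem Fires.matches {r : Rule} {c c' : Pos} (h : Fires r c c') : Matches r c :=
  fun t ht => (h.1 t ht).1

theorem matches_inlineRule {pl : Bool} {x d : Cell} {k m : ℕ} {c : Pos} :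
    Matches (inlineRule pl x d k m) c ↔
      ∀ i ≤ k + m, stepc x i d ∈ cells → c (stepc x i d) = lineContent pl k m i := by
  simp only [Matches, inlineRule, List.mem_map, List.mem_filter, List.mem_range,
    decide_eq_true_eq, forall_exists_index, and_imp, Nat.lt_succ_iff]
  constructor
  · intro h i hi hx
    exact h _ i hi hx rfl
  · rintro h _ i hi hx rfl
    exact h i hi hx

theorem fires_inlineRule {pl : Bool} {x d : Cell} {k m : ℕ} {c : Pos} (hd : d ∈ dirs)
    (hoff : ∀ y, y ∉ cells → c y = none) (hfit : InlineFits x d k m)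
    (hc : Matches (inlineRule pl x d k m) c) :
    Fires (inlineRule pl x d k m) c (shiftResult board223 c x d (k + m)) := by
  refine ⟨fun t ht => ⟨hc t ht, ?_⟩, fun y hy => ?_⟩
  · rw [matches_inlineRule] at hc
    simp only [inlineRule, List.mem_map, List.mem_filter, List.mem_range,
      decide_eq_true_eq] at ht
    obtain ⟨i, ⟨hi, hx⟩, rfl⟩ := ht
    simp only [shiftResult, mem_board223_iff, hx, not_true_eq_false, if_false]
    rcases i with _ | i
    · simp [stepc_zero]
    · have hne : stepc x (i + 1) d ≠ x := by
        intro h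
        have := stepc_left_injective hd x (h.trans (stepc_zero x d).symm)
        omega
      rw [if_neg hne, if_pos ⟨i + 1, by omega, by omega, rfl⟩, addc_stepc_succ_negd,
        if_neg (by omega), Nat.add_sub_cancel]
      exact hc i (by omega) (hfit.1 i (by omega))
  · by_cases hyc : y ∈ cells
    · have hne : ∀ i ≤ k + m, y ≠ stepc x i d := by
        rintro i hi rfl
        refine hy _ (List.mem_map.2 ⟨i, List.mem_filter.2 ⟨?_, ?_⟩, rfl⟩) rfl
        · exact List.mem_range.2 (by omega)
        · simpa using hyc
      simp only [shiftResult, mem_board223_iff, hyc, not_true_eq_false, if_false]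
      rw [if_neg fun h => hne 0 (by omega) (h.trans (stepc_zero x d).symm), if_neg]
      rintro ⟨i, -, hi, h⟩
      exact hne i hi h
    · simp [shiftResult, mem_board223_iff, hyc, hoff y hyc]

theorem inlineMove_of_matches {pl : Bool} {x d : Cell} {k m : ℕ} {c : Pos} (hd : d ∈ dirs)
    (hk : 1 ≤ k) (hk3 : k ≤ 3) (hm : m < k) (hfit : InlineFits x d k m)
    (hc : Matches (inlineRule pl x d k m) c) :
    InlineMove board223 3 pl c (shiftResult board223 c x d (k + m)) := by
  rw [matches_inlineRule] at hc
  refine ⟨x, d, hd, k, m, hk, hk3, hm, fun i hi => ?_, fun i hi hi' => ?_, ?_, rfl⟩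
  · have hx := hfit.1 i (by omega)
    refine ⟨(mem_board223_iff _).2 hx, ?_⟩
    rw [hc i (by omega) hx, lineContent, if_pos hi]
  · have hx := hfit.1 i hi'
    refine ⟨(mem_board223_iff _).2 hx, ?_⟩
    rw [hc i (by omega) hx, lineContent, if_neg (by omega), if_pos hi']
  · rcases Nat.eq_zero_or_pos m with rfl | hm0
    · have hx := hfit.2 rfl
      refine Or.inl ⟨rfl, (mem_board223_iff _).2 hx, ?_⟩
      rw [hc k (by omega) hx, lineContent, if_neg (by omega), if_neg (by omega)]
    · refine Or.inr ⟨hm0, ?_⟩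
      by_cases hx : stepc x (k + m) d ∈ cells
      · right
        rw [hc _ le_rfl hx, lineContent, if_neg (by omega), if_neg (by omega)]
      · exact Or.inl fun h => hx ((mem_board223_iff _).1 h)

theorem exists_fires_of_inlineMove {pl : Bool} {c c' : Pos}
    (hoff : ∀ y, y ∉ cells → c y = none) (h : InlineMove board223 3 pl c c') :
    ∃ r ∈ inlineRules pl, Fires r c c' := by
  obtain ⟨x, d, hd, k, m, hk, hk3, hm, h1, h2, h3, rfl⟩ := h
  simp only [mem_board223_iff] at h1 h2 h3
  have hfit : InlineFits x d k m := by
    refine ⟨fun i hi => ?_, fun hm0 => ?_⟩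
    · rcases lt_or_ge i k with hik | hik
      · exact (h1 i hik).1
      · exact (h2 i hik hi).1
    · rcases h3 with h3 | h3
      · exact h3.2.1
      · omega
  have hx : x ∈ cells := stepc_zero x d ▸ (h1 0 (by omega)).1
  refine ⟨_, mem_inlineRules.2 ⟨x, hx, d, hd, k, m, hk, hk3, hm, hfit, rfl⟩,
    fires_inlineRule hd hoff hfit (matches_inlineRule.2 fun i hi hxi => ?_)⟩
  simp only [lineContent]
  split_ifs with hik hikm
  · exact (h1 i hik).2
  · exact (h2 i (by omega) hikm).2
  · obtain rfl : i = k + m := by omega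
    rcases h3 with ⟨rfl, -, h3⟩ | ⟨-, h3 | h3⟩
    · exact h3
    · exact absurd hxi h3
    · exact h3

theorem matches_broadRule {pl : Bool} {x d e : Cell} {k : ℕ} {c : Pos} :
    Matches (broadRule pl x d e k) c ↔
      ∀ i < k, c (stepc x i d) = some pl ∧ c (addc (stepc x i d) e) = none := by
  simp only [Matches, broadRule, List.mem_append, List.mem_map, List.mem_range]
  constructor
  · exact fun h i hi => ⟨h _ (Or.inl ⟨i, hi, rfl⟩), h _ (Or.inr ⟨i, hi, rfl⟩)⟩
  · rintro h _ (⟨i, hi, rfl⟩ | ⟨i, hi, rfl⟩)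
    exacts [(h i hi).1, (h i hi).2]

theorem fires_broadRule {pl : Bool} {x d e : Cell} {k : ℕ} {c : Pos}
    (hc : Matches (broadRule pl x d e k) c) :
    Fires (broadRule pl x d e k) c (broadResult c pl x d e k) := by
  refine ⟨fun t ht => ⟨hc t ht, ?_⟩, fun y hy => ?_⟩
  · rw [matches_broadRule] at hc
    simp only [broadRule, List.mem_append, List.mem_map, List.mem_range] at ht
    obtain ⟨i, hi, rfl⟩ | ⟨i, hi, rfl⟩ := ht
    · exact if_pos ⟨i, hi, rfl⟩
    · simp only [broadResult]
      rw [if_neg, if_pos ⟨i, hi, rfl⟩]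
      rintro ⟨j, hj, h⟩
      have := (hc j hj).1
      rw [← h, (hc i hi).2] at this
      exact absurd this (by simp)
  · simp only [broadRule, List.mem_append, List.mem_map, List.mem_range] at hy
    simp only [broadResult]
    rw [if_neg, if_neg]
    · rintro ⟨i, hi, rfl⟩
      exact hy _ (Or.inr ⟨i, hi, rfl⟩) rfl
    · rintro ⟨i, hi, rfl⟩
      exact hy _ (Or.inl ⟨i, hi, rfl⟩) rfl

theorem broadsideMove_of_matches {pl : Bool} {x d e : Cell} {k : ℕ} {c : Pos}
    (hd : d ∈ dirs) (he : e ∈ dirs) (hk : 1 ≤ k) (hk3 : k ≤ 3) (hfit : BroadFits x d e k)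
    (hc : Matches (broadRule pl x d e k) c) :
    BroadsideMove board223 3 pl c (broadResult c pl x d e k) := by
  rw [matches_broadRule] at hc
  refine ⟨x, d, e, hd, he, hfit.1, hfit.2.1, k, hk, hk3, fun i hi => ⟨?_, (hc i hi).1⟩,
    fun i hi => ⟨?_, (hc i hi).2⟩, rfl⟩
  · exact (mem_board223_iff _).2 (hfit.2.2 i hi).1
  · exact (mem_board223_iff _).2 (hfit.2.2 i hi).2

theorem exists_fires_of_broadsideMove {pl : Bool} {c c' : Pos}
    (h : BroadsideMove board223 3 pl c c') : ∃ r ∈ broadRules pl, Fires r c c' := by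
  obtain ⟨x, d, e, hd, he, hed, hed', k, hk, hk3, h1, h2, rfl⟩ := h
  simp only [mem_board223_iff] at h1 h2
  have hx : x ∈ cells := stepc_zero x d ▸ (h1 0 (by omega)).1
  exact ⟨_, mem_broadRules.2 ⟨x, hx, d, hd, e, he, k, hk, hk3,
      ⟨hed, hed', fun i hi => ⟨(h1 i hi).1, (h2 i hi).1⟩⟩, rfl⟩,
    fires_broadRule (matches_broadRule.2 fun i hi => ⟨(h1 i hi).2, (h2 i hi).2⟩)⟩

theorem exists_fires_of_move {pl : Bool} {c c' : Pos}
    (hoff : ∀ y, y ∉ cells → c y = none) (h : Move board223 3 pl c c') :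
    ∃ r ∈ rules pl, Fires r c c' := by
  rcases h with h | h
  · obtain ⟨r, hr, hf⟩ := exists_fires_of_inlineMove hoff h
    exact ⟨r, List.mem_append_left _ hr, hf⟩
  · obtain ⟨r, hr, hf⟩ := exists_fires_of_broadsideMove h
    exact ⟨r, List.mem_append_right _ hr, hf⟩

theorem exists_move_of_matches {pl : Bool} {r : Rule} {c : Pos} (hr : r ∈ rules pl)
    (hoff : ∀ y, y ∉ cells → c y = none) (hc : Matches r c) :
    ∃ c', Move board223 3 pl c c' ∧ Fires r c c' := by
  rcases List.mem_append.1 hr with hr | hr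
  · obtain ⟨x, -, d, hd, k, m, hk, hk3, hm, hfit, rfl⟩ := mem_inlineRules.1 hr
    exact ⟨_, Or.inl (inlineMove_of_matches hd hk hk3 hm hfit hc),
      fires_inlineRule hd hoff hfit hc⟩
  · obtain ⟨x, -, d, hd, e, he, k, hk, hk3, hfit, rfl⟩ := mem_broadRules.1 hr
    exact ⟨_, Or.inr (broadsideMove_of_matches hd he hk hk3 hfit hc), fires_broadRule hc⟩

theorem mem_cells_of_mem_rule {pl : Bool} {r : Rule} (hr : r ∈ rules pl)
    {t : Cell × Option Bool × Option Bool} (ht : t ∈ r) : t.1 ∈ cells := by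
  rcases List.mem_append.1 hr with hr | hr
  · obtain ⟨x, -, d, -, k, m, -, -, -, -, rfl⟩ := mem_inlineRules.1 hr
    obtain ⟨i, hi, rfl⟩ := List.mem_map.1 ht
    simpa using (List.mem_filter.1 hi).2
  · obtain ⟨x, -, d, -, e, -, k, -, -, hfit, rfl⟩ := mem_broadRules.1 hr
    simp only [broadRule, List.mem_append, List.mem_map, List.mem_range] at ht
    obtain ⟨i, hi, rfl⟩ | ⟨i, hi, rfl⟩ := ht
    exacts [(hfit.2.2 i hi).1, (hfit.2.2 i hi).2]

theorem slot_injective : ∀ y ∈ cells, ∀ z ∈ cells, ∀ o o' : Option Bool,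
    slot y o = slot z o' → y = z ∧ o = o' := by
  decide +kernel

theorem testBit_mask (l : List (Cell × Option Bool)) (j : ℕ) :
    (mask l).testBit j = true ↔ ∃ t ∈ l, slot t.1 t.2 = j := by
  induction l with
  | nil => simp [mask]
  | cons t l ih =>
    have : mask (t :: l) = 2 ^ slot t.1 t.2 ||| mask l := rfl
    simp [this, Nat.testBit_or, Nat.testBit_two_pow, ih]

/-- The state `s` records the constellation `c`. -/
def Codes (s : ℕ) (c : Pos) : Prop :=
  (∀ y, y ∉ cells → c y = none) ∧
    ∀ y ∈ cells, ∀ o, s.testBit (slot y o) = true ↔ c y = o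

theorem applies_iff_testBit {s : ℕ} {p : ℕ × ℕ} :
    applies s p = true ↔ ∀ j, p.1.testBit j = true → s.testBit j = true := by
  rw [applies, Nat.beq_eq]
  constructor
  · intro h j hj
    rw [← h, Nat.testBit_and] at hj
    exact (Bool.and_eq_true_iff.1 hj).1
  · intro h
    refine Nat.eq_of_testBit_eq fun j => ?_
    rw [Nat.testBit_and]
    cases hj : p.1.testBit j
    · simp
    · simp [h j hj]

theorem Codes.applies_mask_iff {s : ℕ} {c : Pos} (hs : Codes s c)
    {l : List (Cell × Option Bool)} (hl : ∀ t ∈ l, t.1 ∈ cells) (n : ℕ) :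
    applies s (mask l, n) = true ↔ ∀ t ∈ l, c t.1 = t.2 := by
  simp only [applies_iff_testBit, testBit_mask, forall_exists_index, and_imp]
  constructor
  · exact fun h t ht => (hs.2 _ (hl t ht) _).1 (h _ t ht rfl)
  · rintro h _ t ht rfl
    exact (hs.2 _ (hl t ht) _).2 (h t ht)

theorem Codes.applies_ruleMasks_iff {s : ℕ} {c : Pos} (hs : Codes s c) {r : Rule}
    (hr : ∀ t ∈ r, t.1 ∈ cells) : applies s (ruleMasks r) = true ↔ Matches r c := by
  rw [ruleMasks, hs.applies_mask_iff (List.forall_mem_map.2 hr), List.forall_mem_map]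
  rfl

theorem Codes.update {s : ℕ} {c c' : Pos} (hs : Codes s c) {r : Rule}
    (hr : ∀ t ∈ r, t.1 ∈ cells) (h : Fires r c c') : Codes (update s (ruleMasks r)) c' := by
  refine ⟨fun y hy => ?_, fun y hy o => ?_⟩
  · rw [h.2 y fun t ht hty => hy (hty ▸ hr t ht), hs.1 y hy]
  · have hreq : (ruleMasks r).1.testBit (slot y o) = true ↔ ∃ t ∈ r, t.1 = y ∧ t.2.1 = o := by
      simp only [ruleMasks, testBit_mask, List.mem_map]
      constructor
      · rintro ⟨_, ⟨t, ht, rfl⟩, h⟩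
        exact ⟨t, ht, slot_injective _ (hr t ht) _ hy _ _ h⟩
      · rintro ⟨t, ht, rfl, rfl⟩
        exact ⟨_, ⟨t, ht, rfl⟩, rfl⟩
    have hset : (ruleMasks r).2.testBit (slot y o) = true ↔ ∃ t ∈ r, t.1 = y ∧ t.2.2 = o := by
      simp only [ruleMasks, testBit_mask, List.mem_map]
      constructor
      · rintro ⟨_, ⟨t, ht, rfl⟩, h⟩
        exact ⟨t, ht, slot_injective _ (hr t ht) _ hy _ _ h⟩
      · rintro ⟨t, ht, rfl, rfl⟩
        exact ⟨_, ⟨t, ht, rfl⟩, rfl⟩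
    rw [Abalone.update, Nat.testBit_or, Nat.testBit_xor, Bool.or_eq_true, hset]
    by_cases hkey : ∃ t ∈ r, t.1 = y
    · obtain ⟨t, ht, rfl⟩ := hkey
      have hxor : s.testBit (slot t.1 o) = (ruleMasks r).1.testBit (slot t.1 o) := by
        rw [Bool.eq_iff_iff, hreq, hs.2 _ hy]
        constructor
        · exact fun hc => ⟨t, ht, rfl, (h.1 t ht).1.symm.trans hc⟩
        · rintro ⟨t', ht', hy', rfl⟩
          rw [← hy', (h.1 t' ht').1]
      simp only [hxor, Bool.xor_self, Bool.false_eq_true, false_or]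
      constructor
      · rintro ⟨t', ht', hy', rfl⟩
        rw [← hy', (h.1 t' ht').2]
      · exact fun hc => ⟨t, ht, rfl, (h.1 t ht).2.symm.trans hc⟩
    · have hreq' : (ruleMasks r).1.testBit (slot y o) = false := by
        rw [Bool.eq_false_iff, Ne, hreq]
        exact fun ⟨t, ht, hy, _⟩ => hkey ⟨t, ht, hy⟩
      rw [hreq', Bool.xor_false, hs.2 y hy, h.2 y fun t ht hty => hkey ⟨t, ht, hty⟩]
      exact or_iff_left fun ⟨t, ht, hy, _⟩ => hkey ⟨t, ht, hy⟩

theorem countM_board223 (pl : Bool) (c : Pos) :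
    countM board223 pl c = cells.countP fun y => c y = some pl := by
  have hb : board223 = cells.toFinset := by
    ext y
    rw [mem_board223_iff, List.mem_toFinset]
  have hf : (board223.filter fun y => c y = some pl) =
      (cells.filter fun y => c y = some pl).toFinset := by
    rw [hb, List.toFinset_filter]
    simp
  rw [countM, hf, List.toFinset_card_of_nodup (List.Nodup.filter _ (by decide)),
    List.countP_eq_length_filter]

theorem Codes.marbles_eq {s : ℕ} {c : Pos} (hs : Codes s c) (pl : Bool) :
    marbles pl s = countM board223 pl c := by
  rw [countM_board223, marbles]
  refine List.countP_congr fun y hy => ?_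
  rw [hs.2 y hy, decide_eq_true_eq]

theorem map_ruleMasks_subset_blackMoves :
    ∀ p ∈ (rules true).map ruleMasks, p ∈ blackMoves := by
  decide +kernel

theorem blackMoves_subset_map_ruleMasks :
    ∀ p ∈ blackMoves, p ∈ (rules true).map ruleMasks := by
  decide +kernel

theorem grayCaptures_subset_map_ruleMasks :
    ∀ p ∈ grayCaptures, p ∈ (rules false).map ruleMasks := by
  decide +kernel

theorem graySteps_subset_map_ruleMasks :
    ∀ p ∈ graySteps, p ∈ (rules false).map ruleMasks := by
  decide +kernel

theorem Codes.exists_move {s : ℕ} {c : Pos} (hs : Codes s c) {pl : Bool} {p : ℕ × ℕ}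
    (hp : p ∈ (rules pl).map ruleMasks) (hsp : applies s p = true) :
    ∃ c', G223.move pl c c' ∧ Codes (Abalone.update s p) c' := by
  obtain ⟨r, hr, rfl⟩ := List.mem_map.1 hp
  have hk : ∀ t ∈ r, t.1 ∈ cells := fun t ht => mem_cells_of_mem_rule hr ht
  obtain ⟨c', hm, hf⟩ := exists_move_of_matches hr hs.1 ((hs.applies_ruleMasks_iff hk).1 hsp)
  exact ⟨c', hm, hs.update hk hf⟩

theorem Codes.exists_applies {s : ℕ} {c c' : Pos} (hs : Codes s c) {pl : Bool}
    (h : G223.move pl c c') :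
    ∃ p ∈ (rules pl).map ruleMasks, applies s p = true ∧ Codes (Abalone.update s p) c' := by
  obtain ⟨r, hr, hf⟩ := exists_fires_of_move hs.1 h
  have hk : ∀ t ∈ r, t.1 ∈ cells := fun t ht => mem_cells_of_mem_rule hr ht
  exact ⟨_, List.mem_map_of_mem hr, (hs.applies_ruleMasks_iff hk).2 hf.matches,
    hs.update hk hf⟩

theorem Codes.not_win {s : ℕ} {c : Pos} (hs : Codes s c) {pl : Bool}
    (h : Nat.ble 3 (marbles pl s) = true) : ¬ G223.win (!pl) c := by
  have h := Nat.le_of_ble_eq_true h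
  rw [hs.marbles_eq] at h
  simpa [G223, Wins] using h

theorem Codes.fw_of_captures {s : ℕ} {c : Pos} (hs : Codes s c) {pl : Bool}
    {table : List (ℕ × ℕ)} (ht : ∀ p ∈ table, p ∈ (rules pl).map ruleMasks)
    (hm : Nat.ble 3 (marbles pl s) = true) (h : captures table pl s = true) :
    G223.FW pl pl c := by
  simp only [captures, List.any_eq_true, Bool.and_eq_true] at h
  obtain ⟨p, hp, hsp, hlt⟩ := h
  obtain ⟨c', hmove, hs'⟩ := hs.exists_move (ht p hp) hsp
  refine .self c c' (hs.not_win hm) hmove (.terminal _ _ ?_)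
  rw [hs'.marbles_eq, Nat.blt_eq] at hlt
  exact hlt

theorem force_eq (f : ℕ → Bool) (n : ℕ) : force f n = f n := by
  cases n <;> rfl

theorem Codes.fw_of_holds {s : ℕ} {c : Pos} (hs : Codes s c) {f : ℕ → Bool}
    (hf : ∀ s' c', Codes s' c' → f s' = true → G223.FW false false c')
    (h : holds f s = true) : G223.FW false true c := by
  simp only [holds, Bool.and_eq_true, List.any_eq_true, List.all_eq_true, Bool.or_eq_true,
    Bool.not_eq_true', force_eq] at h
  obtain ⟨⟨hm, p, hp, hsp⟩, hall⟩ := h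
  obtain ⟨c₀, hmove, -⟩ := hs.exists_move (blackMoves_subset_map_ruleMasks p hp) hsp
  refine .opp (pl := false) c (hs.not_win hm) ⟨c₀, hmove⟩ fun c' hc' => ?_
  obtain ⟨q, hq, hsq, hs'⟩ := hs.exists_applies hc'
  refine hf _ c' hs' ((hall q (map_ruleMasks_subset_blackMoves q hq)).resolve_left ?_)
  simp [hsq]

theorem Codes.fw_of_grayWins {n s : ℕ} {c : Pos} (hs : Codes s c)
    (h : grayWins n s = true) : G223.FW false false c := by
  induction n generalizing s c with
  | zero =>
    simp only [grayWins, Bool.and_eq_true] at h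
    exact hs.fw_of_captures grayCaptures_subset_map_ruleMasks h.1 h.2
  | succ n ih =>
    simp only [grayWins, Bool.and_eq_true, Bool.or_eq_true, List.any_eq_true, force_eq] at h
    obtain ⟨hm, h | ⟨p, hp, hsp, h⟩⟩ := h
    · exact hs.fw_of_captures grayCaptures_subset_map_ruleMasks hm h
    · obtain ⟨c', hmove, hs'⟩ := hs.exists_move (graySteps_subset_map_ruleMasks p hp) hsp
      exact .self c c' (hs.not_win hm) hmove (hs'.fw_of_holds (fun _ _ => ih) h)

theorem exists_of_forallFillings {f : ℕ → Bool} (c : Pos) {l : List Cell} {s : ℕ}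
    (h : forallFillings f l (l.countP fun y => c y = some true)
      (l.countP fun y => c y = some false) s = true) :
    ∃ s', f s' = true ∧
      ∀ j, s'.testBit j = true ↔ s.testBit j = true ∨ ∃ y ∈ l, slot y (c y) = j := by
  induction l generalizing s with
  | nil =>
    refine ⟨s, ?_, by simp⟩
    simpa [forallFillings, force_eq] using h
  | cons y l ih =>
    simp only [forallFillings, Bool.and_eq_true, Bool.or_eq_true, Nat.beq_eq] at h
    have key : forallFillings f l (l.countP fun y => c y = some true)
        (l.countP fun y => c y = some false) (2 ^ slot y (c y) ||| s) = true := by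
      obtain ⟨ht, hg, hn⟩ := h
      rcases hc : c y with _ | _ | _
      · simpa [hc] using hn
      · simpa [hc] using hg
      · simpa [hc] using ht
    obtain ⟨s', hf, hs'⟩ := ih key
    refine ⟨s', hf, fun j => ?_⟩
    simp only [hs', Nat.testBit_or, Nat.testBit_two_pow, Bool.or_eq_true, decide_eq_true_eq,
      List.mem_cons, exists_eq_or_imp]
    tauto

theorem forallFillings_checkState :
    forallFillings checkState (cells.drop 2) 3 1 middleMask = true := by
  decide +kernel

theorem Codes.containsNeutral {s : ℕ} {c : Pos} (hs : Codes s c)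
    (h : (neutralMasks.any fun q => applies s (q, 0)) = true) : ContainsNeutral (negP c) := by
  have hneg : ∀ y b, negP c y = some b ↔ c y = some (!b) := by
    intro y b
    rcases hc : c y with _ | _ | _ <;> cases b <;> simp [negP, hc]
  simp only [neutralMasks, List.any_cons, List.any_nil, Bool.or_eq_true, Bool.or_false] at h
  simp only [ContainsNeutral, hneg]
  rw [hs.applies_mask_iff (by decide), hs.applies_mask_iff (by decide),
    hs.applies_mask_iff (by decide), hs.applies_mask_iff (by decide)] at h
  simpa using h

theorem exists_codes (c : Pos) (hval : Valid223 c) (he : c ce = some false)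
    (hf : c cf = some false) : ∃ s, Codes s c ∧ checkState s = true := by
  obtain ⟨hoff, hb, hg⟩ := hval
  have hcells : cells = ce :: cf :: cells.drop 2 := rfl
  rw [countM_board223, hcells] at hb hg
  simp only [List.countP_cons, he, hf, Option.some.injEq, decide_false, decide_true,
    Bool.false_eq_true, if_false, if_true] at hb hg
  have hall := forallFillings_checkState
  rw [← show (cells.drop 2).countP (fun y => c y = some true) = 3 by simpa using hb,
    ← show (cells.drop 2).countP (fun y => c y = some false) = 1 by simpa using hg] at hall
  obtain ⟨s, hs, hbit⟩ := exists_of_forallFillings c hall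
  refine ⟨s, ⟨fun y hy => hoff y (mt (mem_board223_iff y).1 hy), fun y hy o => ?_⟩, hs⟩
  have hbit' : s.testBit (slot y o) = true ↔ ∃ z ∈ cells, slot z (c z) = slot y o := by
    rw [hbit, middleMask, testBit_mask, hcells]
    simp only [List.mem_cons, List.not_mem_nil, or_false, exists_eq_or_imp, exists_eq_left,
      he, hf, or_assoc, List.drop_succ_cons, List.drop_zero]
  rw [hbit']
  constructor
  · rintro ⟨z, hz, h⟩
    obtain ⟨rfl, ho⟩ := slot_injective _ hz _ hy _ _ h
    exact ho
  · rintro rfl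
    exact ⟨y, hy, rfl⟩

end Abalone

open Abalone AGame in
/-- in 2×2×3 Abalone, if Gray occupies both middle spaces `e` and `f`,
then either Gray has a winning strategy whoever moves first (`o(C) = R`), or the
negative constellation `-C` contains the neutral subconfiguration, in which case
`o(C) = N`. -/
theorem gray_middle_control (c : Pos) (hval : Valid223 c)
    (he : c ce = some false) (hf : c cf = some false) :
    G223.OutR c ∨ (ContainsNeutral (negP c) ∧ G223.OutN c) := by
  obtain ⟨s, hs, h⟩ := exists_codes c hval he hf
  simp only [checkState, Bool.and_eq_true, Bool.or_eq_true] at h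
  obtain ⟨hgray, hblack | ⟨⟨hneutral, hm⟩, hcap⟩⟩ := h
  · exact Or.inl ⟨hs.fw_of_grayWins hgray, hs.fw_of_holds (fun _ _ => Codes.fw_of_grayWins) hblack⟩
  · exact Or.inr ⟨hs.containsNeutral hneutral,
      hs.fw_of_captures blackMoves_subset_map_ruleMasks hm hcap, hs.fw_of_grayWins hgray⟩
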